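/- arXiv:1604.06136 — 4 statements merged into one kernel-verified Lean document; each statement's English description precedes it below -/
import Mathlib

section
/- If t is a rational number such that t⁴ + t² − 1 is a square of a rational number, then t = 1 or t = −1. -/
/-- A positive factor of a `k`-th power, coprime to its cofactor, is a `k`-th power. -/
theorem Int.exists_eq_pow_of_mul_eq_pow_of_pos {x y z : ℤ} {k : ℕ} (hxy : IsCoprime x y)
    (hx : 0 < x) (h : x * y = z ^ k) : ∃ d : ℤ, x = d ^ k := by
  obtain ⟨d, hd⟩ := exists_associated_pow_of_mul_eq_pow' hxy h
  refine ⟨|d|, ?_⟩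
  rw [Int.associated_iff_natAbs] at hd
  zify at hd
  rw [← abs_pow, hd, abs_of_pos hx]

/-- Coprime positive integers with product `5 * B ^ 4`, the second of which is divisible by `5`. -/
theorem exists_pow_four_of_mul_eq_of_dvd {P Q B : ℤ} (hP : 0 < P) (hQ : 0 < Q)
    (hPQ : IsCoprime P Q) (h : P * Q = 5 * B ^ 4) (h5 : 5 ∣ Q) :
    ∃ u v : ℤ, IsCoprime u v ∧ u ^ 2 * v ^ 2 = B ^ 2 ∧ P + Q = u ^ 4 + 5 * v ^ 4 := by
  obtain ⟨R, rfl⟩ := h5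
  have hR : 0 < R := by lia
  have hPR : IsCoprime P R := hPQ.of_mul_right_right
  have hmul : P * R = B ^ 4 := by linarith
  obtain ⟨u, rfl⟩ := Int.exists_eq_pow_of_mul_eq_pow_of_pos hPR hP hmul
  obtain ⟨v, rfl⟩ := Int.exists_eq_pow_of_mul_eq_pow_of_pos hPR.symm hR
    ((mul_comm _ _).trans hmul)
  refine ⟨u, v, (IsCoprime.pow_iff (by norm_num) (by norm_num)).1 hPR, ?_, rfl⟩
  refine (pow_left_inj₀ (by positivity) (by positivity) two_ne_zero).1 ?_
  linear_combination hmul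

theorem exists_pow_four_of_mul_eq {P Q B : ℤ} (hP : 0 < P) (hQ : 0 < Q)
    (h : P * Q = 5 * B ^ 4) (hB : ∀ p : ℤ, Prime p → p ∣ P → p ∣ Q → ¬ p ∣ B) :
    ∃ u v : ℤ, IsCoprime u v ∧ u ^ 2 * v ^ 2 = B ^ 2 ∧ P + Q = u ^ 4 + 5 * v ^ 4 := by
  have h5 : Prime (5 : ℤ) := by norm_num
  have hPQ : IsCoprime P Q := by
    refine isCoprime_of_prime_dvd (fun h0 => hP.ne' h0.1) fun p hp hpP hpQ => ?_
    have hpB := hB p hp hpP hpQ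
    have hdvd : p * p ∣ 5 * B ^ 4 := h ▸ mul_dvd_mul hpP hpQ
    have hcop : IsCoprime (p * p) (B ^ 4) := by
      have := (hp.coprime_iff_not_dvd.2 hpB).pow_right (n := 4)
      exact this.mul_left this
    have hpp : p * p ∣ 5 := hcop.dvd_of_dvd_mul_right hdvd
    exact hp.not_isUnit (h5.irreducible.squarefree p hpp)
  have hdvd : 5 ∣ P * Q := h ▸ dvd_mul_right _ _
  rcases h5.dvd_or_dvd hdvd with hd | hd
  · rw [add_comm]
    exact exists_pow_four_of_mul_eq_of_dvd hQ hP hPQ.symm ((mul_comm _ _).trans h) hd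
  · exact exists_pow_four_of_mul_eq_of_dvd hP hQ hPQ h hd

/-- Descent step for `a ^ 4 + a ^ 2 * b ^ 2 - b ^ 4 = c ^ 2` with `b` odd. -/
theorem descent_of_odd {a b c : ℤ} (hab : IsCoprime a b) (hb : Odd b)
    (h : a ^ 4 + a ^ 2 * b ^ 2 - b ^ 4 = c ^ 2) :
    ∃ r s u : ℤ, IsCoprime s r ∧ u ^ 2 * (r ^ 2 * s ^ 2) = b ^ 2 ∧
      s ^ 4 + s ^ 2 * r ^ 2 - r ^ 4 = u ^ 2 := by
  have hb0 : b ≠ 0 := by rintro rfl; simp at hb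
  have hmul : (2 * a ^ 2 + b ^ 2 - 2 * c) * (2 * a ^ 2 + b ^ 2 + 2 * c) = 5 * b ^ 4 := by
    linear_combination 4 * h
  have hprod : 0 < 5 * b ^ 4 := by positivity
  have hsum : 0 < 2 * a ^ 2 + b ^ 2 := by positivity
  have hP : 0 < 2 * a ^ 2 + b ^ 2 - 2 * c := by
    by_contra! hn
    nlinarith
  have hQ : 0 < 2 * a ^ 2 + b ^ 2 + 2 * c := by
    by_contra! hn
    nlinarith
  have hdvd : ∀ p : ℤ, Prime p → p ∣ 2 * a ^ 2 + b ^ 2 - 2 * c →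
      p ∣ 2 * a ^ 2 + b ^ 2 + 2 * c → ¬ p ∣ b := by
    intro p hp h1 h2 h3
    have h4 : p ∣ 2 ^ 2 * a ^ 2 := by
      have := (h1.add h2).sub ((h3.mul_left b).mul_left 2)
      ring_nf at this ⊢
      exact this
    rcases hp.dvd_or_dvd h4 with h5 | h5
    · have h6 : IsCoprime b 2 := Int.isCoprime_two_right.2 hb
      exact hp.not_isUnit (h6.isUnit_of_dvd' h3 (hp.dvd_of_dvd_pow h5))
    · exact hp.not_isUnit (hab.isUnit_of_dvd' (hp.dvd_of_dvd_pow h5) h3)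
  obtain ⟨u, v, huv, huvb, hadd⟩ := exists_pow_four_of_mul_eq hP hQ hmul hdvd
  have hodd : Odd (u ^ 2 * v ^ 2) := huvb ▸ hb.pow
  obtain ⟨hu, hv⟩ := Int.odd_mul.1 hodd
  obtain ⟨w, hw⟩ : (2 : ℤ) ∣ u ^ 2 - v ^ 2 := (hu.sub_odd hv).two_dvd
  have hpyth : PythagoreanTriple (v ^ 2) w |a| := by
    have : 4 * a ^ 2 = 4 * (v ^ 4 + w ^ 2) := by
      linear_combination hadd + 2 * huvb + (u ^ 2 - v ^ 2 + 2 * w) * hw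
    unfold PythagoreanTriple
    rw [abs_mul_abs_self]
    linarith
  have hcop : IsCoprime (v ^ 2) w := by
    have h1 : IsCoprime (v ^ 2) (u ^ 2) := huv.symm.pow
    have h2 : IsCoprime (v ^ 2) (2 * w) := by
      rw [← hw]
      simpa [sub_eq_add_neg] using h1.add_mul_left_right (-1)
    exact h2.of_mul_right_right
  have hvpos : 0 < v ^ 2 := by
    have : v ≠ 0 := by rintro rfl; simp at hv
    positivity
  have ha : 0 < |a| := by
    refine abs_pos.2 ?_
    rintro rfl
    unfold PythagoreanTriple at hpyth
    simp at hpyth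
    nlinarith [sq_nonneg w]
  obtain ⟨m, n, hvmn, hwmn, -, hmn, hpar, hm⟩ :=
    hpyth.coprime_classification' (Int.isCoprime_iff_gcd_eq_one.1 hcop) (Int.odd_iff.1 hv) ha
  have hmn' : IsCoprime m n := Int.isCoprime_iff_gcd_eq_one.2 hmn
  have hmul' : (m - n) * (m + n) = v ^ 2 := by linear_combination -hvmn
  have hlt : |n| < m := by
    rw [← abs_of_nonneg hm]
    exact sq_lt_sq.1 (by linarith)
  obtain ⟨hlt1, hlt2⟩ := abs_lt.1 hlt
  have hcop' : IsCoprime (m - n) (m + n) := by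
    have h2 : IsCoprime (m - n) 2 := Int.isCoprime_two_right.2 (by rw [Int.odd_iff]; lia)
    have hn : IsCoprime (m - n) n := by
      simpa [sub_eq_add_neg] using hmn'.add_mul_right_left (-1)
    have := (h2.mul_right hn).add_mul_left_right 1
    rwa [show 2 * n + (m - n) * 1 = m + n by ring] at this
  obtain ⟨r, hr⟩ := Int.exists_eq_pow_of_mul_eq_pow_of_pos hcop' (by linarith) hmul'
  obtain ⟨s, hs⟩ := Int.exists_eq_pow_of_mul_eq_pow_of_pos hcop'.symm (by linarith)
    ((mul_comm _ _).trans hmul')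
  rw [hr, hs] at hmul' hcop'
  refine ⟨r, s, u, (IsCoprime.pow_iff two_pos two_pos).1 hcop'.symm, by rw [hmul', huvb], ?_⟩
  linear_combination (-(s ^ 2) - m - n) * hs + (r ^ 2 + m - n) * hr - hw - 2 * hwmn + hmul'

/-- Descent step for `a ^ 4 + a ^ 2 * b ^ 2 - b ^ 4 = c ^ 2` with `b` even. -/
theorem descent_of_even {a b c : ℤ} (hab : IsCoprime a (2 * b)) (hb : b ≠ 0)
    (h : a ^ 4 + a ^ 2 * (2 * b) ^ 2 - (2 * b) ^ 4 = c ^ 2) :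
    ∃ r s u : ℤ, IsCoprime r s ∧ u ^ 2 * (r ^ 2 * s ^ 2) = b ^ 2 ∧
      r ^ 4 + r ^ 2 * s ^ 2 - s ^ 4 = u ^ 2 ∧ Odd (u ^ 2 - r ^ 2 * s ^ 2) := by
  have ha2 : Odd a := Int.isCoprime_two_right.1 hab.of_mul_right_left
  have hab' : IsCoprime a b := hab.of_mul_right_right
  have hc2 : Odd c := by
    have : Odd (c ^ 2) := by
      rw [← h, show a ^ 4 + a ^ 2 * (2 * b) ^ 2 - (2 * b) ^ 4
        = a ^ 4 + 2 * (2 * a ^ 2 * b ^ 2 - 8 * b ^ 4) by ring]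
      exact ha2.pow.add_even (even_two_mul _)
    exact (Int.odd_pow' two_ne_zero).1 this
  obtain ⟨P, hP⟩ : (2 : ℤ) ∣ a ^ 2 + 2 * b ^ 2 - c :=
    ((ha2.pow.add_even (even_two_mul _)).sub_odd hc2).two_dvd
  obtain ⟨Q, hQ⟩ : (2 : ℤ) ∣ a ^ 2 + 2 * b ^ 2 + c :=
    ((ha2.pow.add_even (even_two_mul _)).add_odd hc2).two_dvd
  have hPQadd : P + Q = a ^ 2 + 2 * b ^ 2 := by linarith
  have hmul : P * Q = 5 * b ^ 4 := by
    have : 4 * (P * Q) = 4 * (5 * b ^ 4) := by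
      calc 4 * (P * Q) = (2 * P) * (2 * Q) := by ring
        _ = 4 * (5 * b ^ 4) := by rw [← hP, ← hQ]; linear_combination h
    linarith
  have hprod : 0 < 5 * b ^ 4 := by positivity
  have hsum : 0 < a ^ 2 + 2 * b ^ 2 := by positivity
  have hP0 : 0 < P := by
    by_contra! hn
    nlinarith
  have hQ0 : 0 < Q := by
    by_contra! hn
    nlinarith
  have hdvd : ∀ p : ℤ, Prime p → p ∣ P → p ∣ Q → ¬ p ∣ b := by
    intro p hp h1 h2 h3
    have h4 : p ∣ a ^ 2 := by
      have := (h1.add h2).sub ((h3.mul_left b).mul_left 2)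
      rw [hPQadd] at this
      ring_nf at this ⊢
      exact this
    exact hp.not_isUnit (hab'.isUnit_of_dvd' (hp.dvd_of_dvd_pow h4) h3)
  obtain ⟨u, v, huv, huvb, hadd⟩ := exists_pow_four_of_mul_eq hP0 hQ0 hmul hdvd
  have hpyth' : a ^ 2 = (u ^ 2 - v ^ 2) ^ 2 + 2 * (2 * v ^ 4) := by
    linear_combination hadd - hPQadd + 2 * huvb
  have hpyth : PythagoreanTriple (u ^ 2 - v ^ 2) (2 * v ^ 2) |a| := by
    unfold PythagoreanTriple
    rw [abs_mul_abs_self]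
    linear_combination -hpyth'
  have hodd : Odd (u ^ 2 - v ^ 2) := by
    have h1 : Odd ((u ^ 2 - v ^ 2) ^ 2) := by
      rw [← sub_eq_of_eq_add hpyth']
      exact ha2.pow.sub_even (even_two_mul _)
    exact (Int.odd_pow' two_ne_zero).1 h1
  have hcop : IsCoprime (u ^ 2 - v ^ 2) (2 * v ^ 2) := by
    refine (Int.isCoprime_two_right.2 hodd).mul_right ?_
    have h1 : IsCoprime (u ^ 2) (v ^ 2) := huv.pow
    simpa [sub_eq_add_neg] using h1.add_mul_right_left (-1)
  have ha : 0 < |a| := abs_pos.2 (by rintro rfl; simp at ha2)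
  have hv : 0 < v ^ 2 := by
    have : v ≠ 0 := by
      rintro rfl
      simp at huvb
      exact hb (pow_eq_zero_iff two_ne_zero |>.1 huvb.symm)
    positivity
  obtain ⟨m, n, humn, hvmn, -, hmn, -, hm⟩ :=
    hpyth.coprime_classification' (Int.isCoprime_iff_gcd_eq_one.1 hcop) (Int.odd_iff.1 hodd) ha
  have hmn' : IsCoprime m n := Int.isCoprime_iff_gcd_eq_one.2 hmn
  have hmul' : m * n = v ^ 2 := by linarith
  have hn0 : 0 < n := pos_of_mul_pos_right (hmul' ▸ hv) hm
  have hm0 : 0 < m := pos_of_mul_pos_left (hmul' ▸ hv) hn0.le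
  obtain ⟨r, rfl⟩ := Int.exists_eq_pow_of_mul_eq_pow_of_pos hmn' hm0 hmul'
  obtain ⟨s, rfl⟩ := Int.exists_eq_pow_of_mul_eq_pow_of_pos hmn'.symm hn0
    ((mul_comm _ _).trans hmul')
  refine ⟨r, s, u, (IsCoprime.pow_iff two_pos two_pos).1 hmn', by rw [hmul', huvb], ?_,
    by rwa [hmul']⟩
  linear_combination hmul' - humn

theorem sq_eq_one_of_pow_four_add_sq_sub_one_eq_sq {a c : ℤ} (h : a ^ 4 + a ^ 2 - 1 = c ^ 2) :
    a ^ 2 = 1 := by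
  have ha : 0 ≤ a ^ 2 := sq_nonneg a
  by_contra hne
  rcases lt_or_gt_of_ne hne with hlt | hgt
  · have h0 : a ^ 2 = 0 := by lia
    nlinarith [sq_nonneg c]
  · have h1 : |a ^ 2| < |c| := sq_lt_sq.1 (by linarith)
    have h2 : |c| < |a ^ 2 + 1| := sq_lt_sq.1 (by linarith)
    rw [abs_of_nonneg ha] at h1
    rw [abs_of_nonneg (a := a ^ 2 + 1) (by linarith)] at h2
    lia

theorem sq_eq_one_of_pow_four_add_sub_eq_sq {a b c : ℤ} (hab : IsCoprime a b) (hb : b ≠ 0)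
    (h : a ^ 4 + a ^ 2 * b ^ 2 - b ^ 4 = c ^ 2) : a ^ 2 = 1 ∧ b ^ 2 = 1 := by
  induction hN : b.natAbs using Nat.strong_induction_on generalizing a b c with
  | _ N ih =>
  subst hN
  suffices hb1 : b ^ 2 = 1 by
    refine ⟨sq_eq_one_of_pow_four_add_sq_sub_one_eq_sq (c := c) ?_, hb1⟩
    linear_combination h + (b ^ 2 + 1 - a ^ 2) * hb1
  rcases Int.even_or_odd' b with ⟨β, rfl | hodd⟩
  · have hβ : β ≠ 0 := by rintro rfl; simp at hb
    obtain ⟨r, s, u, hrs, hprod, heq, hpar⟩ := descent_of_even hab hβ h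
    have hs0 : s ≠ 0 := by rintro rfl; exact pow_ne_zero 2 hβ (by linarith)
    have hsβ : s ∣ β := (Int.pow_dvd_pow_iff two_ne_zero).1
      (hprod ▸ ((dvd_mul_left _ _).mul_left _))
    have hle := Int.natAbs_le_of_dvd_ne_zero hsβ hβ
    obtain ⟨hr1, hs1⟩ := ih s.natAbs (by lia) hrs hs0 heq rfl
    have hu1 : u ^ 2 = 1 := by
      linear_combination -heq + (r ^ 2 + 1 + s ^ 2) * hr1 - s ^ 2 * hs1
    rw [hu1, hr1, hs1] at hpar
    norm_num at hpar
  · obtain ⟨r, s, u, hrs, hprod, heq⟩ := descent_of_odd hab ⟨β, hodd⟩ h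
    have hr0 : r ≠ 0 := by rintro rfl; exact pow_ne_zero 2 hb (by linarith)
    have hrb : r ∣ b := (Int.pow_dvd_pow_iff two_ne_zero).1
      (hprod ▸ ((dvd_mul_right _ _).mul_left _))
    rcases (Int.natAbs_le_of_dvd_ne_zero hrb hb).lt_or_eq with hlt | heqrb
    · obtain ⟨hs1, hr1⟩ := ih r.natAbs hlt hrs hr0 heq rfl
      have hu1 : u ^ 2 = 1 := by
        linear_combination -heq + (s ^ 2 + 1 + r ^ 2) * hs1 - r ^ 2 * hr1
      rw [← hprod, hu1, hr1, hs1]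
      norm_num
    · have hsq : r ^ 2 = b ^ 2 := Int.natAbs_eq_iff_sq_eq.1 heqrb
      have hr2 : r ^ 2 ≠ 0 := pow_ne_zero 2 hr0
      have hus : u ^ 2 * s ^ 2 = 1 := mul_right_cancel₀ hr2 (by linear_combination hprod - hsq)
      have hu1 : u ^ 2 = 1 := Int.eq_one_of_mul_eq_one_right (sq_nonneg u) hus
      have hs1 : s ^ 2 = 1 := by rwa [hu1, one_mul] at hus
      rw [← hsq]
      refine mul_right_cancel₀ hr2 ?_
      linear_combination -heq - hu1 + (s ^ 2 + 1 + r ^ 2) * hs1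

theorem stmt_2 (t : ℚ) (h : ∃ y : ℚ, y ^ 2 = t ^ 4 + t ^ 2 - 1) : t = 1 ∨ t = -1 := by
  obtain ⟨y, hy⟩ := h
  have hnum : (t.num : ℚ) = t * t.den := (Rat.mul_den_eq_num t).symm
  have hsq : (y * t.den ^ 2) ^ 2 =
      ((t.num ^ 4 + t.num ^ 2 * (t.den : ℤ) ^ 2 - (t.den : ℤ) ^ 4 : ℤ) : ℚ) := by
    push_cast
    rw [hnum]
    linear_combination (t.den : ℚ) ^ 4 * hy
  obtain ⟨c, hc⟩ : IsSquare (t.num ^ 4 + t.num ^ 2 * (t.den : ℤ) ^ 2 - (t.den : ℤ) ^ 4) :=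
    Rat.isSquare_intCast_iff.1 ⟨y * t.den ^ 2, by rw [← hsq, sq]⟩
  obtain ⟨hn, hd⟩ := sq_eq_one_of_pow_four_add_sub_eq_sq (Rat.isCoprime_num_den t)
    (by exact_mod_cast t.den_ne_zero) (hc.trans (sq c).symm)
  have hn' : (t.num : ℚ) ^ 2 = 1 := by exact_mod_cast hn
  have hd' : (t.den : ℚ) ^ 2 = 1 := by exact_mod_cast hd
  rw [hnum, mul_pow, hd', mul_one] at hn'
  simpa using hn'
end

section
/- The group of rational points of the elliptic curve E₁ : y² = x³ + x² + 4x + 4 over ℚ is isomorphic to ℤ/6ℤ; in particular E₁(ℚ) is finite of order 6 (the torsion subgroup is ℤ/6ℤ and the rank is 0). -/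
/-- The elliptic curve `E₁ : y² = x³ + x² + 4x + 4` over a field `K`. -/
noncomputable def E1 (K : Type*) [Field K] : WeierstrassCurve.Affine K where
  a₁ := 0
  a₂ := 1
  a₃ := 0
  a₄ := 4
  a₆ := 4

open WeierstrassCurve.Affine

/-- Two coprime positive integers whose product is a `k`-th power are both `k`-th powers. -/
lemma exists_pow_of_isCoprime_mul_eq_pow {x y z : ℤ} {k : ℕ} (hk : k ≠ 0) (hx : 0 < x)
    (hy : 0 < y) (hz : 0 < z) (hxy : IsCoprime x y) (h : x * y = z ^ k) :
    ∃ p q : ℤ, 0 < p ∧ 0 < q ∧ IsCoprime p q ∧ x = p ^ k ∧ y = q ^ k ∧ z = p * q := by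
  have root : ∀ {u v : ℤ}, 0 < u → IsCoprime u v → u * v = z ^ k → ∃ p : ℤ, 0 < p ∧ u = p ^ k := by
    intro u v hu huv huvz
    obtain ⟨d, hd⟩ := exists_associated_pow_of_mul_eq_pow' huv huvz
    have habs : u = |d| ^ k := by
      rw [Int.associated_iff_natAbs] at hd
      rw [← abs_pow, ← abs_of_pos hu, Int.abs_eq_natAbs, Int.abs_eq_natAbs, hd]
    refine ⟨|d|, abs_pos.2 ?_, habs⟩
    rintro rfl
    simp [hk] at habs
    omega
  obtain ⟨p, hp, rfl⟩ := root hx hxy h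
  obtain ⟨q, hq, rfl⟩ := root hy hxy.symm (by rw [mul_comm, h])
  refine ⟨p, q, hp, hq, (IsCoprime.pow_iff hk.bot_lt hk.bot_lt).1 hxy, rfl, rfl, ?_⟩
  rw [← mul_pow] at h
  exact (pow_left_inj₀ hz.le (mul_pos hp hq).le hk).1 h.symm

/-- Two coprime positive integers with product `5 r⁴` are of the form `s⁴` and `5 t⁴`. -/
lemma exists_add_eq_of_mul_eq_five_mul_pow {x y r : ℤ} (hx : 0 < x) (hy : 0 < y) (hr : 0 < r)
    (hxy : IsCoprime x y) (h : x * y = 5 * r ^ 4) :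
    ∃ s t : ℤ, 0 < s ∧ 0 < t ∧ IsCoprime s t ∧ r = s * t ∧ x + y = s ^ 4 + 5 * t ^ 4 := by
  have five : Prime (5 : ℤ) := by norm_num
  wlog hdvd : 5 ∣ y generalizing x y
  · have hdvd' : 5 ∣ x := (five.dvd_or_dvd (h ▸ dvd_mul_right _ _)).resolve_right hdvd
    obtain ⟨s, t, hs, ht, hst, hrst, hsum⟩ :=
      this hy hx hxy.symm (by rw [mul_comm, h]) hdvd'
    exact ⟨s, t, hs, ht, hst, hrst, by rw [add_comm, hsum]⟩
  obtain ⟨w, rfl⟩ := hdvd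
  obtain ⟨s, t, hs, ht, hst, rfl, rfl, hrst⟩ := exists_pow_of_isCoprime_mul_eq_pow
    (k := 4) (by norm_num) hx (by linarith) hr hxy.of_mul_right_right (by linarith)
  exact ⟨s, t, hs, ht, hst, hrst, rfl⟩

lemma dvd_of_dvd_of_mul_eq_five_mul_pow {x y r z : ℤ} (hz : Prime z) (hx : z ∣ x) (hy : z ∣ y)
    (h : x * y = 5 * r ^ 4) : z ∣ r := by
  have five : Prime (5 : ℤ) := by norm_num
  rcases hz.dvd_or_dvd (h ▸ hx.mul_right y) with h5 | hr
  · have hassoc := hz.associated_of_dvd five h5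
    refine hassoc.dvd.trans (five.dvd_of_dvd_pow (n := 4) ?_)
    obtain ⟨u, rfl⟩ := hassoc.symm.dvd.trans hx
    obtain ⟨v, rfl⟩ := hassoc.symm.dvd.trans hy
    exact ⟨u * v, by linarith⟩
  · exact hz.dvd_of_dvd_pow hr

lemma pos_and_pos_of_mul_pos_of_add_pos {x y : ℤ} (hmul : 0 < x * y) (hadd : 0 < x + y) :
    0 < x ∧ 0 < y := by
  rcases pos_and_pos_or_neg_and_neg_of_mul_pos hmul with h | ⟨hx, hy⟩
  · exact h
  · omega

/-- The first half of the descent on `a⁴ - 2 a² c² + 5 c⁴ = b²`. -/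
lemma exists_sq_eq_of_quartic_eq_sq {a b c : ℤ} (hb : 0 < b) (hc : 0 < c)
    (hac : IsCoprime a c) (h : a ^ 4 - 2 * a ^ 2 * c ^ 2 + 5 * c ^ 4 = b ^ 2) :
    ∃ p q : ℤ, 0 < p ∧ 0 < q ∧ IsCoprime p q ∧ Odd q ∧ c = p * q ∧
      a ^ 2 = q ^ 4 + p ^ 2 * q ^ 2 - p ^ 4 := by
  have hpar : Even (b - (a ^ 2 - c ^ 2)) := by
    have : Even (b ^ 2 - (a ^ 2 - c ^ 2) ^ 2) := ⟨2 * c ^ 4, by rw [← h]; ring⟩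
    simpa [Int.even_sub, Int.even_pow] using this
  obtain ⟨x, hx⟩ := hpar
  obtain ⟨y, hy⟩ : ∃ y, y = x + (a ^ 2 - c ^ 2) := ⟨_, rfl⟩
  have hxy : x * y = c ^ 4 := by
    have hbx : b = 2 * x + (a ^ 2 - c ^ 2) := by linarith
    subst hbx hy
    nlinarith
  have hprod : 0 < x * y := hxy ▸ pow_pos hc 4
  have hsum : 0 < x + y := by linarith
  obtain ⟨hx0, hy0⟩ := pos_and_pos_of_mul_pos_of_add_pos hprod hsum
  have hcop : IsCoprime x y := by
    refine isCoprime_of_prime_dvd (by rintro ⟨rfl, -⟩; exact hx0.false) fun z hz hzx hzy => ?_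
    have hzc : z ∣ c := hz.dvd_of_dvd_pow (hxy ▸ hzx.mul_right y)
    have hza : z ∣ a := hz.dvd_of_dvd_pow (n := 2) (by
      have : a ^ 2 = y - x + c ^ 2 := by linarith
      rw [this]
      exact (hzy.sub hzx).add (hzc.pow two_ne_zero))
    exact hz.not_isUnit (hac.isUnit_of_dvd' hza hzc)
  obtain ⟨p, q, hp, hq, hpq, rfl, rfl, rfl⟩ :=
    exists_pow_of_isCoprime_mul_eq_pow (by norm_num) hx0 hy0 hc hcop hxy
  have ha : a ^ 2 = q ^ 4 + p ^ 2 * q ^ 2 - p ^ 4 := by linarith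
  refine ⟨p, q, hp, hq, hpq, ?_, rfl, ha⟩
  by_contra hq2
  obtain ⟨m, rfl⟩ := (Int.not_odd_iff_even.1 hq2).two_dvd
  have hp2 : Odd p := by
    by_contra hp2
    have := hpq.isUnit_of_dvd' (Int.not_odd_iff_even.1 hp2).two_dvd (dvd_mul_right 2 m)
    exact (by decide : ¬ IsUnit (2 : ℤ)) this
  obtain ⟨n, rfl⟩ := hp2
  have hmod := congrArg (Int.cast : ℤ → ZMod 4) ha
  push_cast at hmod
  generalize (a : ZMod 4) = a, (m : ZMod 4) = m, (n : ZMod 4) = n at hmod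
  revert a m n
  decide

/-- The second half of the descent, for odd `p`. -/
lemma exists_quartic_eq_sq_of_odd {a p q : ℤ} (hp : 0 < p) (hpq : IsCoprime p q) (hodd : Odd p)
    (h : a ^ 2 = q ^ 4 + p ^ 2 * q ^ 2 - p ^ 4) :
    ∃ s t : ℤ, 0 < s ∧ 0 < t ∧ IsCoprime s t ∧ p = s * t ∧
      s ^ 4 - 2 * s ^ 2 * t ^ 2 + 5 * t ^ 4 = (2 * q) ^ 2 := by
  have hxy : (2 * q ^ 2 + p ^ 2 - 2 * a) * (2 * q ^ 2 + p ^ 2 + 2 * a) = 5 * p ^ 4 := by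
    linear_combination (-4) * h
  obtain ⟨hx, hy⟩ := pos_and_pos_of_mul_pos_of_add_pos (hxy ▸ by positivity)
    (show 0 < (2 * q ^ 2 + p ^ 2 - 2 * a) + (2 * q ^ 2 + p ^ 2 + 2 * a) by
      ring_nf; positivity)
  have hcop : IsCoprime (2 * q ^ 2 + p ^ 2 - 2 * a) (2 * q ^ 2 + p ^ 2 + 2 * a) := by
    refine isCoprime_of_prime_dvd (fun h0 => hx.ne' h0.1) fun z hz hzx hzy => ?_
    have hzp := dvd_of_dvd_of_mul_eq_five_mul_pow hz hzx hzy hxy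
    have hz2 : ¬ z ∣ 2 := fun hz2 =>
      hz.not_isUnit ((Int.isCoprime_two_left.2 hodd).isUnit_of_dvd' hz2 hzp)
    have hzq : z ∣ 2 * (2 * q ^ 2) := by
      have := (hzx.add hzy).sub ((hzp.pow two_ne_zero).mul_left 2)
      ring_nf at this ⊢
      exact this
    have hzq := (hz.dvd_or_dvd hzq).resolve_left hz2
    have hzq := hz.dvd_of_dvd_pow ((hz.dvd_or_dvd hzq).resolve_left hz2)
    exact hz.not_isUnit (hpq.isUnit_of_dvd' hzp hzq)
  obtain ⟨s, t, hs, ht, hst, rfl, hsum⟩ :=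
    exists_add_eq_of_mul_eq_five_mul_pow hx hy hp hcop hxy
  exact ⟨s, t, hs, ht, hst, rfl, by linarith⟩

/-- The second half of the descent, for even `p = 2 r`. -/
lemma exists_quartic_eq_sq_of_even {a r q : ℤ} (hr : 0 < r) (hrq : IsCoprime r q) (hq : Odd q)
    (h : a ^ 2 = q ^ 4 + (2 * r) ^ 2 * q ^ 2 - (2 * r) ^ 4) :
    ∃ s t : ℤ, 0 < s ∧ 0 < t ∧ IsCoprime s t ∧ r = s * t ∧
      s ^ 4 - 2 * s ^ 2 * t ^ 2 + 5 * t ^ 4 = q ^ 2 := by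
  have hpar : Even (q ^ 2 + 2 * r ^ 2 - a) := by
    have ha : Odd (a ^ 2) := by
      rw [h]
      exact ((hq.pow.add_even ⟨2 * r ^ 2 * q ^ 2, by ring⟩).sub_even ⟨8 * r ^ 4, by ring⟩)
    have ha : Odd a := (Int.odd_pow' two_ne_zero).1 ha
    exact (hq.pow.add_even (even_two_mul _)).sub_odd ha
  obtain ⟨x, hx⟩ := hpar
  obtain ⟨y, hy⟩ : ∃ y, y = x + a := ⟨_, rfl⟩
  have hadd : x + y = q ^ 2 + 2 * r ^ 2 := by linarith
  have hxy : x * y = 5 * r ^ 4 := by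
    have ha : a = y - x := by linarith
    have h4 : 4 * (x * y) = (q ^ 2 + 2 * r ^ 2) ^ 2 - a ^ 2 := by rw [← hadd, ha]; ring
    rw [h] at h4
    linarith
  obtain ⟨hx0, hy0⟩ := pos_and_pos_of_mul_pos_of_add_pos (hxy ▸ by positivity)
    (show 0 < x + y by rw [hadd]; positivity)
  have hcop : IsCoprime x y := by
    refine isCoprime_of_prime_dvd (fun h0 => hx0.ne' h0.1) fun z hz hzx hzy => ?_
    have hzr := dvd_of_dvd_of_mul_eq_five_mul_pow hz hzx hzy hxy
    have hzq : z ∣ q := hz.dvd_of_dvd_pow (n := 2) (by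
      rw [show q ^ 2 = x + y - 2 * r ^ 2 by linarith]
      exact (hzx.add hzy).sub ((hzr.pow two_ne_zero).mul_left 2))
    exact hz.not_isUnit (hrq.isUnit_of_dvd' hzr hzq)
  obtain ⟨s, t, hs, ht, hst, rfl, hsum⟩ :=
    exists_add_eq_of_mul_eq_five_mul_pow hx0 hy0 hr hcop hxy
  exact ⟨s, t, hs, ht, hst, rfl, by linarith⟩

/-- The only coprime positive solution of `a⁴ - 2 a² c² + 5 c⁴ = b²` is `a = c = 1`. -/
theorem eq_one_of_quartic_eq_sq {a b c : ℤ} (ha : 0 < a) (hc : 0 < c) (hac : IsCoprime a c)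
    (h : a ^ 4 - 2 * a ^ 2 * c ^ 2 + 5 * c ^ 4 = b ^ 2) : a = 1 ∧ c = 1 := by
  induction hn : c.toNat using Nat.strong_induction_on generalizing a b c with
  | _ n ih =>
  subst hn
  have hb : b ≠ 0 := by
    rintro rfl
    nlinarith [sq_nonneg (a ^ 2 - c ^ 2), pow_pos hc 4]
  rw [← sq_abs b] at h
  obtain ⟨p, q, hp, hq, hpq, hqodd, hcpq, hapq⟩ :=
    exists_sq_eq_of_quartic_eq_sq (abs_pos.2 hb) hc hac h
  rcases Int.even_or_odd p with heven | hodd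
  · obtain ⟨r, rfl⟩ := heven.two_dvd
    obtain ⟨s, t, hs, ht, hst, rfl, hq2⟩ :=
      exists_quartic_eq_sq_of_even (by linarith) hpq.of_mul_left_right hqodd hapq
    have htc : t < c := by
      rw [hcpq]
      nlinarith [mul_pos hs ht, mul_pos (mul_pos hs ht) hq, mul_pos ht hq]
    obtain ⟨rfl, rfl⟩ := ih t.toNat (by omega) hs ht hst hq2 rfl
    obtain ⟨k, rfl⟩ := hqodd
    ring_nf at hq2
    omega
  · obtain ⟨s, t, hs, ht, hst, rfl, hq2⟩ := exists_quartic_eq_sq_of_odd hp hpq hodd hapq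
    have hone : s = 1 ∧ t = 1 := by
      rcases lt_or_ge t c with htc | htc
      · exact ih t.toNat (by omega) hs ht hst hq2 rfl
      · have hsq : s * q ≤ 1 := by
          by_contra hsq
          nlinarith
        obtain rfl : s = 1 := by nlinarith
        obtain rfl : q = 1 := by linarith
        refine ⟨rfl, ?_⟩
        have : (5 * t ^ 2 + 3) * ((t + 1) * (t - 1)) = 0 := by linear_combination hq2
        have h1 : (t + 1) * (t - 1) = 0 := (mul_eq_zero.1 this).resolve_left (by positivity)
        have := (mul_eq_zero.1 h1).resolve_left (by linarith)
        linarith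
    obtain ⟨rfl, rfl⟩ := hone
    obtain rfl : q = 1 := by nlinarith
    exact ⟨by nlinarith, by linarith⟩

/-- If `n`, `d` are coprime positive integers and `n d (n² - 2 n d + 5 d²)` is a square, then `n / d`
is `1` or `5`. -/
theorem eq_one_or_five_of_mul_eq_sq {n d w : ℤ} (hn : 0 < n) (hd : 0 < d) (hnd : IsCoprime n d)
    (h : d * (n * (n ^ 2 - 2 * n * d + 5 * d ^ 2)) = w ^ 2) : d = 1 ∧ (n = 1 ∨ n = 5) := by
  have five : Prime (5 : ℤ) := by norm_num
  have hQ : 0 < n ^ 2 - 2 * n * d + 5 * d ^ 2 := by nlinarith [sq_nonneg (n - d), pow_pos hd 2]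
  have hw : 0 < |w| := by
    rw [abs_pos]
    rintro rfl
    have : 0 < d * (n * (n ^ 2 - 2 * n * d + 5 * d ^ 2)) := by positivity
    linarith
  rw [← sq_abs w] at h
  have hdQ : IsCoprime d (n ^ 2 - 2 * n * d + 5 * d ^ 2) := by
    rw [show n ^ 2 - 2 * n * d + 5 * d ^ 2 = n ^ 2 + d * (5 * d - 2 * n) by ring]
    exact (hnd.symm.pow_right).add_mul_left_right (5 * d - 2 * n)
  obtain ⟨c, v, hc, hv, -, rfl, hv2, -⟩ := exists_pow_of_isCoprime_mul_eq_pow two_ne_zero hd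
    (mul_pos hn hQ) hw (hnd.symm.mul_right hdQ) h
  by_cases h5 : 5 ∣ n
  · obtain ⟨m, rfl⟩ := h5
    have hm : 0 < m := by linarith
    obtain ⟨u, rfl⟩ : 5 ∣ v := five.dvd_of_dvd_pow (n := 2) (hv2 ▸ ⟨_, mul_assoc _ _ _⟩)
    have hcop : IsCoprime m (5 * m ^ 2 - 2 * m * c ^ 2 + c ^ 4) := by
      rw [show 5 * m ^ 2 - 2 * m * c ^ 2 + c ^ 4 = (c ^ 2) ^ 2 + m * (5 * m - 2 * c ^ 2) by ring]
      exact (hnd.of_mul_left_right.pow_right).add_mul_left_right (5 * m - 2 * c ^ 2)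
    obtain ⟨a, b, ha, hb, -, rfl, hb2, -⟩ := exists_pow_of_isCoprime_mul_eq_pow (z := u)
      two_ne_zero hm (by nlinarith) (by linarith) hcop (by linarith)
    obtain ⟨rfl, rfl⟩ := eq_one_of_quartic_eq_sq (a := c) (c := a) (b := b) hc ha
      ((IsCoprime.pow_iff two_pos two_pos).1 hnd.of_mul_left_right).symm
      (by rw [← hb2]; ring)
    simp
  · have hcop : IsCoprime n (n ^ 2 - 2 * n * c ^ 2 + 5 * (c ^ 2) ^ 2) := by
      have hn5 : IsCoprime n 5 := ((five.irreducible.coprime_iff_not_dvd).2 h5).symm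
      rw [show n ^ 2 - 2 * n * c ^ 2 + 5 * (c ^ 2) ^ 2 = 5 * (c ^ 2) ^ 2 + n * (n - 2 * c ^ 2) by ring]
      exact (hn5.mul_right (hnd.pow_right)).add_mul_left_right (n - 2 * c ^ 2)
    obtain ⟨a, b, ha, hb, -, rfl, hb2, -⟩ := exists_pow_of_isCoprime_mul_eq_pow
      two_ne_zero hn hQ hv hcop hv2
    obtain ⟨rfl, rfl⟩ := eq_one_of_quartic_eq_sq (a := a) (c := c) (b := b) ha hc
      ((IsCoprime.pow_iff two_pos two_pos).1 hnd) (by rw [← hb2]; ring)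
    simp

lemma E1_equation_iff {x y : ℚ} : (E1 ℚ).Equation x y ↔ y ^ 2 = x ^ 3 + x ^ 2 + 4 * x + 4 := by
  simp [equation_iff, E1]

theorem x_eq_of_E1_equation {x y : ℚ} (h : y ^ 2 = x ^ 3 + x ^ 2 + 4 * x + 4) :
    x = -1 ∨ x = 0 ∨ x = 4 := by
  obtain ⟨u, rfl⟩ : ∃ u, x = u - 1 := ⟨x + 1, by ring⟩
  have hu : y ^ 2 = u * (u ^ 2 - 2 * u + 5) := by rw [h]; ring
  rcases eq_or_ne u 0 with rfl | hu0
  · norm_num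
  have hQ : 0 < u ^ 2 - 2 * u + 5 := by nlinarith [sq_nonneg (u - 1)]
  have hupos : 0 < u := lt_of_le_of_ne
    (nonneg_of_mul_nonneg_left (hu ▸ sq_nonneg y) hQ) hu0.symm
  have hd : (0 : ℤ) < u.den := by exact_mod_cast u.den_pos
  have hdQ : (u.den : ℚ) ≠ 0 := by exact_mod_cast u.den_ne_zero
  have hsq : IsSquare (((u.den * (u.num * (u.num ^ 2 - 2 * u.num * u.den + 5 * u.den ^ 2)) : ℤ)) :
      ℚ) := by
    refine ⟨y * u.den ^ 2, ?_⟩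
    have hnum : (u.num : ℚ) = u * u.den := (Rat.mul_den_eq_num u).symm
    push_cast
    rw [hnum]
    linear_combination (-(u.den : ℚ) ^ 4) * hu
  obtain ⟨w, hw⟩ := Rat.isSquare_intCast_iff.1 hsq
  obtain ⟨hden, hnum⟩ := eq_one_or_five_of_mul_eq_sq (Rat.num_pos.2 hupos) hd
    (Int.isCoprime_iff_gcd_eq_one.2 u.reduced) (hw.trans (sq w).symm)
  have huz : u = u.num := by
    conv_lhs => rw [← Rat.num_div_den u]
    rw [show (u.den : ℚ) = 1 by exact_mod_cast hden, div_one]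
  rcases hnum with hnum | hnum <;> rw [hnum] at huz <;> rw [huz] <;> norm_num

lemma E1_nonsingular_iff {x y : ℚ} :
    (E1 ℚ).Nonsingular x y ↔ y ^ 2 = x ^ 3 + x ^ 2 + 4 * x + 4 := by
  rw [← equation_iff_nonsingular_of_Δ_ne_zero, E1_equation_iff]
  norm_num [E1, WeierstrassCurve.Δ, WeierstrassCurve.b₂, WeierstrassCurve.b₄,
    WeierstrassCurve.b₆, WeierstrassCurve.b₈]

lemma E1_point_cases (P : (E1 ℚ).Point) :
    P = 0 ∨ P = .some (-1) 0 (E1_nonsingular_iff.2 (by norm_num)) ∨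
      P = .some 0 2 (E1_nonsingular_iff.2 (by norm_num)) ∨
      P = .some 0 (-2) (E1_nonsingular_iff.2 (by norm_num)) ∨
      P = .some 4 10 (E1_nonsingular_iff.2 (by norm_num)) ∨
      P = .some 4 (-10) (E1_nonsingular_iff.2 (by norm_num)) := by
  rcases P with _ | ⟨x, y, h⟩
  · exact .inl rfl
  have hxy := E1_nonsingular_iff.1 h
  simp only [Point.some_ne_zero, Point.some.injEq, false_or]
  rcases x_eq_of_E1_equation hxy with rfl | rfl | rfl
  · have : y = 0 := by simpa using hxy.trans (by norm_num : _ = (0 : ℚ))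
    simp [this]
  · have := sq_eq_sq_iff_eq_or_eq_neg.1 (hxy.trans (by norm_num : _ = (2 : ℚ) ^ 2))
    simpa using this
  · have := sq_eq_sq_iff_eq_or_eq_neg.1 (hxy.trans (by norm_num : _ = (10 : ℚ) ^ 2))
    norm_num [this]

/-- The point `(4, 10)` of `E₁`, which generates `E₁(ℚ)`. -/
noncomputable def E1Generator : (E1 ℚ).Point := .some 4 10 (E1_nonsingular_iff.2 (by norm_num))

lemma two_nsmul_E1Generator :
    2 • E1Generator = .some 0 2 (E1_nonsingular_iff.2 (by norm_num)) := by
  have hne : (10 : ℚ) ≠ (E1 ℚ).negY 4 10 := by norm_num [negY, E1]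
  rw [two_nsmul, E1Generator, Point.add_self_of_Y_ne hne, Point.some.injEq,
    slope_of_Y_ne rfl hne]
  norm_num [addX, addY, negAddY, negY, E1]

lemma three_nsmul_E1Generator :
    3 • E1Generator = .some (-1) 0 (E1_nonsingular_iff.2 (by norm_num)) := by
  have hne : (0 : ℚ) ≠ 4 := by norm_num
  rw [succ_nsmul, two_nsmul_E1Generator, E1Generator, Point.add_of_X_ne hne, Point.some.injEq,
    slope_of_X_ne hne]
  norm_num [addX, addY, negAddY, negY, E1]

lemma six_nsmul_E1Generator : 6 • E1Generator = 0 := by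
  rw [show 6 = 3 * 2 from rfl, mul_nsmul, three_nsmul_E1Generator, two_nsmul]
  exact Point.add_self_of_Y_eq (by norm_num [negY, E1])

lemma addOrderOf_E1Generator : addOrderOf E1Generator = 6 := by
  refine addOrderOf_eq_of_nsmul_and_div_prime_nsmul (by norm_num) six_nsmul_E1Generator ?_
  intro p hp hdvd
  have hle := Nat.le_of_dvd (by norm_num) hdvd
  interval_cases p <;> revert hp hdvd <;> norm_num
  · exact three_nsmul_E1Generator ▸ Point.some_ne_zero _
  · exact two_nsmul_E1Generator ▸ Point.some_ne_zero _

lemma mem_zmultiples_E1Generator (P : (E1 ℚ).Point) : P ∈ AddSubgroup.zmultiples E1Generator := by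
  have hP : E1Generator ∈ AddSubgroup.zmultiples E1Generator :=
    AddSubgroup.mem_zmultiples E1Generator
  rcases E1_point_cases P with rfl | rfl | rfl | rfl | rfl | rfl
  · exact zero_mem _
  · exact three_nsmul_E1Generator ▸ nsmul_mem hP 3
  · exact two_nsmul_E1Generator ▸ nsmul_mem hP 2
  · convert neg_mem (two_nsmul_E1Generator ▸ nsmul_mem hP 2) using 1
    rw [Point.neg_some, Point.some.injEq]
    simp [negY, E1]
  · exact hP
  · convert neg_mem hP using 1
    rw [E1Generator, Point.neg_some, Point.some.injEq]
    simp [negY, E1]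

theorem stmt_4 : Nonempty ((E1 ℚ).Point ≃+ ZMod 6) := by
  have hcyc : IsAddCyclic (E1 ℚ).Point := ⟨E1Generator, mem_zmultiples_E1Generator⟩
  have hcard : Nat.card (E1 ℚ).Point = 6 := by
    rw [← addOrderOf_E1Generator]
    exact (addOrderOf_eq_card_of_forall_mem_zmultiples mem_zmultiples_E1Generator).symm
  exact ⟨(hcard ▸ zmodAddCyclicAddEquiv hcyc).symm⟩
end

section
/- Let t be a rational number with t ∉ {−1, 0, 1}, and set a = 18t(t²−1)/((t²−6t+1)(t²+6t+1)), b = (t−1)(t²+6t+1)²/(6t(t+1)(t²−6t+1)), c = (t+1)(t²−6t+1)²/(6t(t−1)(t²+6t+1)). Then a, b, c are nonzero rational numbers and each of ab+1, ac+1 and bc+1 is a square of a rational number. -/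
theorem rat_sq_ne_eight (x : ℚ) : x ^ 2 ≠ 8 := by
  intro h
  have hsq : IsSquare (8 : ℚ) := ⟨x, by rw [← h, sq]⟩
  have hnat : IsSquare (8 : ℕ) := Rat.isSquare_natCast_iff.mp (by exact_mod_cast hsq)
  obtain ⟨n, hn⟩ := hnat
  have : n < 3 := by nlinarith
  interval_cases n <;> omega

theorem stmt_10 (t : ℚ) (ht1 : t ≠ -1) (ht2 : t ≠ 0) (ht3 : t ≠ 1)
    (a b c : ℚ)
    (ha : a = 18 * t * (t ^ 2 - 1) / ((t ^ 2 - 6 * t + 1) * (t ^ 2 + 6 * t + 1)))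
    (hb : b = (t - 1) * (t ^ 2 + 6 * t + 1) ^ 2 / (6 * t * (t + 1) * (t ^ 2 - 6 * t + 1)))
    (hc : c = (t + 1) * (t ^ 2 - 6 * t + 1) ^ 2 / (6 * t * (t - 1) * (t ^ 2 + 6 * t + 1))) :
    a ≠ 0 ∧ b ≠ 0 ∧ c ≠ 0 ∧ (∃ y : ℚ, y ^ 2 = a * b + 1) ∧ (∃ y : ℚ, y ^ 2 = a * c + 1) ∧
      ∃ y : ℚ, y ^ 2 = b * c + 1 := by
  have hm : t ^ 2 - 6 * t + 1 ≠ 0 := fun h => rat_sq_ne_eight (t - 3) (by linear_combination h)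
  have hp : t ^ 2 + 6 * t + 1 ≠ 0 := fun h => rat_sq_ne_eight (t + 3) (by linear_combination h)
  have hm' : t * (t - 6) + 1 ≠ 0 := fun h => hm (by linear_combination h)
  have hp' : t * (t + 6) + 1 ≠ 0 := fun h => hp (by linear_combination h)
  have hs : t - 1 ≠ 0 := sub_ne_zero.mpr ht3
  have hr : t + 1 ≠ 0 := fun h => ht1 (by linear_combination h)
  have hq : t ^ 2 - 1 = (t - 1) * (t + 1) := by ring
  rw [hq] at ha
  subst ha hb hc
  refine ⟨by positivity, by positivity, by positivity,
    ⟨2 * (t ^ 2 + 1) / (t ^ 2 - 6 * t + 1), ?_⟩,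
    ⟨2 * (t ^ 2 + 1) / (t ^ 2 + 6 * t + 1), ?_⟩, ⟨(t ^ 2 + 1) / (6 * t), ?_⟩⟩
  all_goals
    field_simp
    ring
end

section
/- Let u be a rational number with u ∉ {0, 1, −1, 3, −3}, and set a = (u³ − 9u)/(6(u² − 1)), b = −9(u² − 1)/(2(u³ − 9u)), c = −16u(u² − 3)/(3(u⁴ − 10u² + 9)). Then a, b, c are nonzero rational numbers and each of ab+1, ac+1 and bc+1 is a square of a rational number. -/
theorem Rat.sq_ne_three (u : ℚ) : u ^ 2 ≠ 3 := by
  intro h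
  have hs : IsSquare ((3 : ℕ) : ℚ) := ⟨u, by rw [← sq, h]; norm_num⟩
  rw [Rat.isSquare_natCast_iff] at hs
  exact Nat.prime_three.prime.irreducible.not_isSquare hs

theorem stmt_17 (u : ℚ) (hu0 : u ≠ 0) (hu1 : u ≠ 1) (hu2 : u ≠ -1) (hu3 : u ≠ 3) (hu4 : u ≠ -3)
    (a b c : ℚ)
    (ha : a = (u ^ 3 - 9 * u) / (6 * (u ^ 2 - 1)))
    (hb : b = -9 * (u ^ 2 - 1) / (2 * (u ^ 3 - 9 * u)))
    (hc : c = -16 * u * (u ^ 2 - 3) / (3 * (u ^ 4 - 10 * u ^ 2 + 9))) :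
    a ≠ 0 ∧ b ≠ 0 ∧ c ≠ 0 ∧ (∃ y : ℚ, y ^ 2 = a * b + 1) ∧ (∃ y : ℚ, y ^ 2 = a * c + 1) ∧
      ∃ y : ℚ, y ^ 2 = b * c + 1 := by
  have h1 : u ^ 2 - 1 ≠ 0 := by
    rw [show u ^ 2 - 1 = (u - 1) * (u - (-1)) by ring]
    exact mul_ne_zero (sub_ne_zero.2 hu1) (sub_ne_zero.2 hu2)
  have h9 : u ^ 2 - 9 ≠ 0 := by
    rw [show u ^ 2 - 9 = (u - 3) * (u - (-3)) by ring]
    exact mul_ne_zero (sub_ne_zero.2 hu3) (sub_ne_zero.2 hu4)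
  have h3 : u ^ 2 - 3 ≠ 0 := sub_ne_zero.2 (Rat.sq_ne_three u)
  rw [show u ^ 3 - 9 * u = u * (u ^ 2 - 9) by ring] at ha hb
  rw [show u ^ 4 - 10 * u ^ 2 + 9 = (u ^ 2 - 1) * (u ^ 2 - 9) by ring] at hc
  subst ha hb hc
  refine ⟨by simp [*], by simp [*], by simp [*], ⟨1 / 2, ?_⟩,
    ⟨(u ^ 2 + 3) / (3 * (u ^ 2 - 1)), ?_⟩, ⟨(u ^ 2 + 3) / (u ^ 2 - 9), ?_⟩⟩
  all_goals
    field_simp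
    ring
end
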